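/- Let Ω be a finite nonempty type with cardinality m, let s be a positive natural number, let y : Ω → ℝ, and let w : Ω → ℝ be nonnegative weights. Under the uniform distribution on ω : Fin s → Ω, define the weighted stochastic tensor entries ỹ_i(ω) = c_i(ω) · (m / s) · w_i · y_i, where c_i(ω) = card { j : Fin s | ω j = i }. Then for every i ∈ Ω, E[ỹ_i] = w_i · y_i; i.e., the uniformly sampled stochastic tensor is an entrywise unbiased estimator of the weighted elementwise partial gradient tensor with entries w_i y_i. -/

import Mathlib

/-- The functions `ι → Ω` taking a given value at a given point make up a fraction
`1 / card Ω` of all functions. -/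
lemma card_mul_card_filter_apply_eq {ι Ω : Type*} [Fintype ι] [DecidableEq ι] [Fintype Ω]
    [DecidableEq Ω] (j : ι) (i : Ω) :
    Fintype.card Ω * (Finset.univ.filter fun ω : ι → Ω => ω j = i).card
      = Fintype.card (ι → Ω) := by
  have h := Fintype.card_filter_piFinset_const_eq_of_mem (Finset.univ : Finset Ω) j
    (Finset.mem_univ i)
  rw [Fintype.piFinset_univ, Finset.card_univ] at h
  rw [h, Fintype.card_fun, mul_pow_sub_one (Fintype.card_pos_iff.2 ⟨j⟩).ne']

/-- Summed over all functions `ι → Ω`, the sizes of the fibres over a given point average to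
`card ι / card Ω`. -/
lemma card_mul_sum_card_filter_eq {ι Ω : Type*} [Fintype ι] [DecidableEq ι] [Fintype Ω]
    [DecidableEq Ω] (i : Ω) :
    Fintype.card Ω * ∑ ω : ι → Ω, (Finset.univ.filter fun j : ι => ω j = i).card
      = Fintype.card ι * Fintype.card (ι → Ω) := by
  have h : ∑ ω : ι → Ω, (Finset.univ.filter fun j : ι => ω j = i).card
      = ∑ j : ι, (Finset.univ.filter fun ω : ι → Ω => ω j = i).card := by
    simp only [Finset.card_filter]
    exact Finset.sum_comm
  simp [h, Finset.mul_sum, card_mul_card_filter_apply_eq]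

/-- Weighted GCP: under uniform sampling of `s` indices with replacement from a
finite nonempty set `Ω` of cardinality `m`, the weighted stochastic tensor with
entries `ỹ_i(ω) = c_i(ω) · (m/s) · w_i · y_i` is an entrywise unbiased estimator
of the weighted elementwise partial gradient tensor with entries `w_i y_i`. -/
theorem weighted_uniform_sampling_unbiased
    {Ω : Type*} [Fintype Ω] [Nonempty Ω] [DecidableEq Ω]
    (m : ℕ) (hm : Fintype.card Ω = m)
    (s : ℕ) (hs : 0 < s)
    (y : Ω → ℝ) (w : Ω → ℝ) (hw : ∀ i, 0 ≤ w i) (i : Ω) :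
    ((Fintype.card (Fin s → Ω) : ℝ))⁻¹ *
      ∑ ω : Fin s → Ω,
        (((Finset.univ.filter fun j : Fin s => ω j = i).card : ℝ) *
          ((m : ℝ) / (s : ℝ)) * w i * y i)
    = w i * y i := by
  have h := card_mul_sum_card_filter_eq (ι := Fin s) i
  rw [hm, Fintype.card_fin] at h
  have h_real : (m : ℝ) * ∑ ω : Fin s → Ω, ((Finset.univ.filter fun j : Fin s => ω j = i).card : ℝ)
      = s * (Fintype.card (Fin s → Ω) : ℝ) := by
    exact_mod_cast h
  have hs_ne : (s : ℝ) ≠ 0 := by exact_mod_cast hs.ne'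
  have h_card : (Fintype.card (Fin s → Ω) : ℝ) ≠ 0 := by exact_mod_cast Fintype.card_ne_zero
  simp only [← Finset.sum_mul]
  field_simp
  linear_combination (w i * y i) * h_real
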